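/- arXiv:2211.06625 — 4 statements merged into one kernel-verified Lean document; each statement's English description precedes it below -/
import Mathlib

section
/- Policy improvement: for every policy σ and every policy π' that is greedy with respect to V^σ, the value of π' is pointwise no worse than the value of σ, i.e., V^{π'}_t(x) ≤ V^σ_t(x) for all t ∈ Fin (T+1) and all states x. -/
/-- Value function of a policy `π`, defined by backward recursion:
`V^π_T(x) = lT x` and for `t < T`,
`V^π_t(x) = l t x (π t x) + V^π_{t+1}(f t x (π t x))`. -/
def val {S U : Type*} (T : ℕ) (f : Fin T → S → U → S) (l : Fin T → S → U → ℝ)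
    (lT : S → ℝ) (π : Fin T → S → U) : Fin (T + 1) → S → ℝ
  | t, x =>
    if h : (t : ℕ) < T then
      l ⟨t, h⟩ x (π ⟨t, h⟩ x) +
        val T f l lT π ⟨(t : ℕ) + 1, by omega⟩ (f ⟨t, h⟩ x (π ⟨t, h⟩ x))
    else lT x
  termination_by t _ => T - (t : ℕ)
  decreasing_by omega

/-- `π'` is greedy with respect to `W`. -/
def IsGreedy {S U : Type*} (T : ℕ) (f : Fin T → S → U → S) (l : Fin T → S → U → ℝ)
    (π' : Fin T → S → U) (W : Fin (T + 1) → S → ℝ) : Prop :=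
  ∀ (t : Fin T) (x : S) (u : U),
    l t x (π' t x) + W t.succ (f t x (π' t x)) ≤ l t x u + W t.succ (f t x u)

/-- The optimal value function: pointwise minimum of `val` over all (finitely many) policies. -/
noncomputable def optVal {S U : Type*} [Fintype S] [DecidableEq S] [Fintype U] [Nonempty U]
    (T : ℕ) (f : Fin T → S → U → S) (l : Fin T → S → U → ℝ) (lT : S → ℝ) :
    Fin (T + 1) → S → ℝ :=
  fun t x =>
    Finset.univ.inf' Finset.univ_nonempty (fun π : Fin T → S → U => val T f l lT π t x)

theorem val_last {S U : Type*} (T : ℕ) (f : Fin T → S → U → S) (l : Fin T → S → U → ℝ)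
    (lT : S → ℝ) (π : Fin T → S → U) (x : S) : val T f l lT π (Fin.last T) x = lT x := by
  rw [val, dif_neg (by simp)]

theorem val_castSucc {S U : Type*} (T : ℕ) (f : Fin T → S → U → S) (l : Fin T → S → U → ℝ)
    (lT : S → ℝ) (π : Fin T → S → U) (t : Fin T) (x : S) :
    val T f l lT π t.castSucc x =
      l t x (π t x) + val T f l lT π t.succ (f t x (π t x)) := by
  rw [val, dif_pos (show (t.castSucc : ℕ) < T from t.isLt)]
  rfl

variable {S U : Type*} [Fintype S] [DecidableEq S] [Nonempty S] [Fintype U] [Nonempty U]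
  (T : ℕ) (f : Fin T → S → U → S) (l : Fin T → S → U → ℝ) (lT : S → ℝ)

theorem policy_improvement (σ π' : Fin T → S → U)
    (hgreedy : IsGreedy T f l π' (val T f l lT σ)) :
    ∀ (t : Fin (T + 1)) (x : S), val T f l lT π' t x ≤ val T f l lT σ t x := by
  intro t
  induction t using Fin.reverseInduction with
  | last => intro x; rw [val_last, val_last]
  | cast t ih =>
    intro x
    rw [val_castSucc, val_castSucc]
    calc
      l t x (π' t x) + val T f l lT π' t.succ (f t x (π' t x))
          ≤ l t x (π' t x) + val T f l lT σ t.succ (f t x (π' t x)) := by gcongr; exact ih _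
      _ ≤ l t x (σ t x) + val T f l lT σ t.succ (f t x (σ t x)) := hgreedy t x (σ t x)
end

section
/- Sharpened policy improvement: for every policy σ and every policy π' that is greedy with respect to V^σ, for all t < T and all states x, V^{π'}_t(x) ≤ min over u ∈ U of [l_t(x, u) + V^σ_{t+1}(f_t(x, u))]. -/
theorem IsGreedy.val_le {S U : Type*} {T : ℕ} {f : Fin T → S → U → S} {l : Fin T → S → U → ℝ}
    {lT : S → ℝ} {σ π' : Fin T → S → U} (h : IsGreedy T f l π' (val T f l lT σ))
    (t : Fin (T + 1)) : ∀ x : S, val T f l lT π' t x ≤ val T f l lT σ t x := by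
  induction t using Fin.reverseInduction with
  | last => intro x; rw [val_last, val_last]
  | cast t ih =>
    intro x
    rw [val_castSucc, val_castSucc]
    exact (add_le_add_right (ih _) _).trans (h t x (σ t x))

variable {S U : Type*} [Fintype S] [DecidableEq S] [Nonempty S] [Fintype U] [Nonempty U]
  (T : ℕ) (f : Fin T → S → U → S) (l : Fin T → S → U → ℝ) (lT : S → ℝ)

theorem sharpened_policy_improvement (σ π' : Fin T → S → U)
    (hgreedy : IsGreedy T f l π' (val T f l lT σ)) :
    ∀ (t : Fin T) (x : S),
      val T f l lT π' t.castSucc x ≤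
        Finset.univ.inf' Finset.univ_nonempty
          (fun u : U => l t x u + val T f l lT σ t.succ (f t x u)) := by
  intro t x
  refine Finset.le_inf' _ _ fun u _ => ?_
  rw [val_castSucc]
  exact (add_le_add_right (hgreedy.val_le t.succ _) _).trans (hgreedy t x u)
end

section
/- One full CACTO iteration is monotone: let TO be a TO-operator, π a policy, σ = TO(π), and π' a policy greedy with respect to V^σ. Then for all t and x, V^{TO(π')}_t(x) ≤ V^{π'}_t(x) ≤ V^σ_t(x) ≤ V^π_t(x). -/
variable {S U : Type*} [Fintype S] [DecidableEq S] [Nonempty S] [Fintype U] [Nonempty U]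
  (T : ℕ) (f : Fin T → S → U → S) (l : Fin T → S → U → ℝ) (lT : S → ℝ)

/-- One step of the backward recursion defining `val`. -/
theorem val_castSucc_s4 {X A : Type*} {N : ℕ} (g : Fin N → X → A → X) (c : Fin N → X → A → ℝ)
    (cN : X → ℝ) (p : Fin N → X → A) (t : Fin N) (x : X) :
    val N g c cN p t.castSucc x = c t x (p t x) + val N g c cN p t.succ (g t x (p t x)) := by
  rw [val, dif_pos (show (t.castSucc : ℕ) < N from t.isLt)]
  rfl

/-- The terminal condition of the backward recursion defining `val`. -/
theorem val_last_s4 {X A : Type*} {N : ℕ} (g : Fin N → X → A → X) (c : Fin N → X → A → ℝ)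
    (cN : X → ℝ) (p : Fin N → X → A) (x : X) :
    val N g c cN p (Fin.last N) x = cN x := by
  rw [val, dif_neg (by simp)]

/-- Policy improvement: a policy that is greedy with respect to the value function of `p`
costs no more than `p`. -/
theorem IsGreedy.val_le_s4 {X A : Type*} {N : ℕ} {g : Fin N → X → A → X} {c : Fin N → X → A → ℝ}
    {cN : X → ℝ} {p p' : Fin N → X → A} (h : IsGreedy N g c p' (val N g c cN p))
    (t : Fin (N + 1)) (x : X) : val N g c cN p' t x ≤ val N g c cN p t x := by
  induction t using Fin.reverseInduction generalizing x with
  | last => rw [val_last_s4, val_last_s4]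
  | cast t ih =>
    rw [val_castSucc_s4, val_castSucc_s4]
    exact (add_le_add_right (ih _) _).trans (h t x (p t x))

theorem cacto_iteration_monotone
    (TO : (Fin T → S → U) → (Fin T → S → U))
    (hTO : ∀ (p : Fin T → S → U) (t : Fin (T + 1)) (x : S),
      val T f l lT (TO p) t x ≤ val T f l lT p t x)
    (π σ π' : Fin T → S → U) (hσ : σ = TO π)
    (hgreedy : IsGreedy T f l π' (val T f l lT σ)) :
    ∀ (t : Fin (T + 1)) (x : S),
      val T f l lT (TO π') t x ≤ val T f l lT π' t x ∧
      val T f l lT π' t x ≤ val T f l lT σ t x ∧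
      val T f l lT σ t x ≤ val T f l lT π t x := by
  subst hσ
  exact fun t x => ⟨hTO π' t x, hgreedy.val_le_s4 t x, hTO π t x⟩
end

section
/- Existence of an optimal policy: there exists a policy π* such that V^{π*}_t(x) = V*_t(x) for all t ∈ Fin (T+1) and all states x. -/
/-- A solution of the Bellman equation, by backward recursion. -/
noncomputable def bellmanVal {S U : Type*} (T : ℕ) (f : Fin T → S → U → S)
    (l : Fin T → S → U → ℝ) (lT : S → ℝ) : Fin (T + 1) → S → ℝ :=
  Fin.reverseInduction (motive := fun _ => S → ℝ) lT
    (fun t W x => ⨅ u : U, (l t x u + W (f t x u)))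

theorem bellmanVal_last {S U : Type*} (T : ℕ) (f : Fin T → S → U → S)
    (l : Fin T → S → U → ℝ) (lT : S → ℝ) : bellmanVal T f l lT (Fin.last T) = lT := by
  simp [bellmanVal]

theorem bellmanVal_castSucc {S U : Type*} (T : ℕ) (f : Fin T → S → U → S)
    (l : Fin T → S → U → ℝ) (lT : S → ℝ) (t : Fin T) (x : S) :
    bellmanVal T f l lT t.castSucc x =
      ⨅ u : U, (l t x u + bellmanVal T f l lT t.succ (f t x u)) := by
  simp [bellmanVal]

theorem exists_isGreedy {S U : Type*} [Finite U] [Nonempty U] (T : ℕ) (f : Fin T → S → U → S)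
    (l : Fin T → S → U → ℝ) (W : Fin (T + 1) → S → ℝ) :
    ∃ π : Fin T → S → U, IsGreedy T f l π W := by
  choose π hπ using fun (t : Fin T) (x : S) =>
    Finite.exists_min fun u => l t x u + W t.succ (f t x u)
  exact ⟨π, hπ⟩

theorem bellmanVal_le_val {S U : Type*} [Finite U] (T : ℕ) (f : Fin T → S → U → S)
    (l : Fin T → S → U → ℝ) (lT : S → ℝ) (π : Fin T → S → U) (t : Fin (T + 1)) (x : S) :
    bellmanVal T f l lT t x ≤ val T f l lT π t x := by
  induction t using Fin.reverseInduction generalizing x with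
  | last => rw [bellmanVal_last, val_last]
  | cast t ih =>
    rw [bellmanVal_castSucc, val_castSucc]
    exact (ciInf_le (Set.finite_range _).bddBelow (π t x)).trans (by gcongr; exact ih _)

theorem IsGreedy.val_le_bellmanVal {S U : Type*} [Nonempty U] {T : ℕ} {f : Fin T → S → U → S}
    {l : Fin T → S → U → ℝ} {lT : S → ℝ} {π : Fin T → S → U}
    (hπ : IsGreedy T f l π (bellmanVal T f l lT)) (t : Fin (T + 1)) (x : S) :
    val T f l lT π t x ≤ bellmanVal T f l lT t x := by
  induction t using Fin.reverseInduction generalizing x with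
  | last => rw [bellmanVal_last, val_last]
  | cast t ih =>
    rw [bellmanVal_castSucc, val_castSucc]
    exact le_ciInf fun u => (by gcongr; exact ih _ : _ ≤ _).trans (hπ t x u)

variable {S U : Type*} [Fintype S] [DecidableEq S] [Nonempty S] [Fintype U] [Nonempty U]
  (T : ℕ) (f : Fin T → S → U → S) (l : Fin T → S → U → ℝ) (lT : S → ℝ)

theorem exists_optimal_policy :
    ∃ πstar : Fin T → S → U,
      ∀ (t : Fin (T + 1)) (x : S), val T f l lT πstar t x = optVal T f l lT t x := by
  obtain ⟨π, hπ⟩ := exists_isGreedy T f l (bellmanVal T f l lT)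
  refine ⟨π, fun t x => le_antisymm ?_ (Finset.inf'_le _ (Finset.mem_univ π))⟩
  exact Finset.le_inf' _ _ fun π' _ =>
    (hπ.val_le_bellmanVal t x).trans (bellmanVal_le_val T f l lT π' t x)
end
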